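/- Let p be a prime, d ≥ 1, and w : Z_p^d → [0,∞) with support E = {x : w(x) ≠ 0} nonempty. If B ⊆ Z_p^d is a spectrum for L²(w), then w is constant on its support; that is, w = c·1_E for some constant c > 0. -/

import Mathlib

open Finset

/-- The fixed character `χ(t) = e^{2πi t/p}` of `ℤ/p`. -/
noncomputable def chi (p : ℕ) (t : ZMod p) : ℂ :=
  Complex.exp (2 * Real.pi * Complex.I * (t.val : ℂ) / (p : ℂ))

/-- The dot product on `ℤ_p^d`. -/
def dotp {p d : ℕ} (x y : Fin d → ZMod p) : ZMod p := ∑ i, x i * y i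

/-- The Gabor (time-frequency shifted) function `x ↦ g(x-a) χ(x·b)`. -/
noncomputable def gabor {p d : ℕ} (g : (Fin d → ZMod p) → ℂ) (a b : Fin d → ZMod p) :
    (Fin d → ZMod p) → ℂ :=
  fun x => g (x - a) * chi p (dotp x b)

/-- The inner product of `L²` with counting measure on a finite type. -/
noncomputable def innerC {V : Type*} [Fintype V] (f g : V → ℂ) : ℂ :=
  ∑ x, f x * (starRingEnd ℂ) (g x)

/-- `𝒢(g, A, B)` is an orthonormal basis of `L²(ℤ_p^d)`: the family is orthonormal and
every function is a linear combination of its members. -/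
def IsGaborONB {p d : ℕ} [NeZero p] (g : (Fin d → ZMod p) → ℂ)
    (A B : Finset (Fin d → ZMod p)) : Prop :=
  (∀ a ∈ A, ∀ b ∈ B, ∀ a' ∈ A, ∀ b' ∈ B,
    innerC (gabor g a b) (gabor g a' b') = if a = a' ∧ b = b' then 1 else 0)
  ∧ (∀ f : (Fin d → ZMod p) → ℂ, ∃ c : (Fin d → ZMod p) → (Fin d → ZMod p) → ℂ,
      f = fun x => ∑ a ∈ A, ∑ b ∈ B, c a b * gabor g a b x)

/-- `(E, B)` is a spectral pair: the characters indexed by `B` are pairwise orthogonal in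
`L²(E)` and span it. -/
def IsSpectralPair {p d : ℕ} [NeZero p] (E B : Finset (Fin d → ZMod p)) : Prop :=
  (∀ b ∈ B, ∀ b' ∈ B, b ≠ b' → ∑ x ∈ E, chi p (dotp x (b - b')) = 0)
  ∧ (∀ f : (Fin d → ZMod p) → ℂ, ∃ c : (Fin d → ZMod p) → ℂ,
      ∀ x ∈ E, f x = ∑ b ∈ B, c b * chi p (dotp x b))

/-- `(E, A)` is a tiling pair: `Σ_{a∈A} 1_E(x-a) = 1` for every `x`. -/
def IsTilingPair {p d : ℕ} [NeZero p] (E A : Finset (Fin d → ZMod p)) : Prop :=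
  ∀ x : Fin d → ZMod p, (∑ a ∈ A, if x - a ∈ E then (1 : ℕ) else 0) = 1

/-- The Fourier transform `ĝ(m) = p^{-d} Σ_x χ(-x·m) g(x)` on `ℤ_p^d`. -/
noncomputable def ft {p d : ℕ} [NeZero p] (g : (Fin d → ZMod p) → ℂ)
    (m : Fin d → ZMod p) : ℂ :=
  ((p : ℂ) ^ d)⁻¹ * ∑ x, chi p (-(dotp x m)) * g x

/-- `B` is a spectrum for `L²(w)`: the characters indexed by `B` are pairwise orthogonal
with respect to the weight `w` and every function agrees on the support of `w` with a
linear combination of them. -/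
def IsSpectrumW {p d : ℕ} [NeZero p] (w : (Fin d → ZMod p) → ℝ)
    (B : Finset (Fin d → ZMod p)) : Prop :=
  (∀ b ∈ B, ∀ b' ∈ B, b ≠ b' → ∑ x, chi p (dotp x (b - b')) * (w x : ℂ) = 0)
  ∧ (∀ f : (Fin d → ZMod p) → ℂ, ∃ c : (Fin d → ZMod p) → ℂ,
      ∀ x, w x ≠ 0 → f x = ∑ b ∈ B, c b * chi p (dotp x b))

theorem chi_eq_stdAddChar (p : ℕ) [NeZero p] (t : ZMod p) : chi p t = ZMod.stdAddChar t := by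
  rw [ZMod.stdAddChar_apply, ZMod.toCircle_apply, chi]

theorem chi_zero (p : ℕ) [NeZero p] : chi p 0 = 1 := by
  rw [chi_eq_stdAddChar, AddChar.map_zero_eq_one]

theorem chi_add (p : ℕ) [NeZero p] (s t : ZMod p) : chi p (s + t) = chi p s * chi p t := by
  simp only [chi_eq_stdAddChar, AddChar.map_add_eq_mul]

theorem dotp_zero {p d : ℕ} (x : Fin d → ZMod p) : dotp x 0 = 0 := by
  simp [dotp]

theorem dotp_sub {p d : ℕ} (x y z : Fin d → ZMod p) :
    dotp x (y - z) = dotp x y + -dotp x z := by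
  rw [← sub_eq_add_neg]
  simp [dotp, mul_sub]

/-- The coefficient of `χ(x·b)` in an expansion over a spectrum is the normalized inner product. -/
theorem IsSpectrumW.coeff_mul_sum {p d : ℕ} [NeZero p] {w : (Fin d → ZMod p) → ℝ}
    {B : Finset (Fin d → ZMod p)} (hB : IsSpectrumW w B) {f c : (Fin d → ZMod p) → ℂ}
    (hf : ∀ x, w x ≠ 0 → f x = ∑ b ∈ B, c b * chi p (dotp x b))
    {b : Fin d → ZMod p} (hb : b ∈ B) :
    c b * ∑ x, (w x : ℂ) = ∑ x, f x * chi p (-dotp x b) * (w x : ℂ) := by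
  have expand : ∀ x, f x * chi p (-dotp x b) * (w x : ℂ)
      = ∑ b' ∈ B, c b' * (chi p (dotp x (b' - b)) * (w x : ℂ)) := by
    intro x
    by_cases hx : w x = 0
    · simp [hx]
    · rw [hf x hx, Finset.sum_mul, Finset.sum_mul]
      refine Finset.sum_congr rfl fun b' _ => ?_
      rw [dotp_sub, chi_add]
      ring
  rw [Finset.sum_congr rfl fun x _ => expand x, Finset.sum_comm, Finset.sum_eq_single_of_mem b hb]
  · simp [dotp_zero, chi_zero, Finset.mul_sum]
  · intro b' hb' hne
    rw [← Finset.mul_sum, hB.1 b' hb' b hb hne, mul_zero]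

/-- On its support, a weight with spectrum `B` equals its total mass divided by `#B`. -/
theorem IsSpectrumW.card_mul_eq_sum {p d : ℕ} [NeZero p] {w : (Fin d → ZMod p) → ℝ}
    {B : Finset (Fin d → ZMod p)} (hB : IsSpectrumW w B) {y : Fin d → ZMod p} (hy : w y ≠ 0) :
    (B.card : ℝ) * w y = ∑ x, w x := by
  obtain ⟨c, hc⟩ := hB.2 (Pi.single y 1)
  have coeff : ∀ b ∈ B, c b * chi p (dotp y b) * ∑ x, (w x : ℂ) = w y := by
    intro b hb
    have h := (hB.coeff_mul_sum hc hb).trans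
      (Finset.sum_eq_single y (fun x _ hx => by simp [hx]) (by simp))
    rw [Pi.single_eq_same] at h
    have hinv : chi p (dotp y b) * chi p (-dotp y b) = 1 := by
      rw [← chi_add, add_neg_cancel, chi_zero]
    linear_combination chi p (dotp y b) * h + (w y : ℂ) * hinv
  have h := hc y hy
  rw [Pi.single_eq_same] at h
  have key : ((B.card : ℂ)) * w y = ∑ x, (w x : ℂ) := by
    rw [← one_mul (∑ x, (w x : ℂ)), h, Finset.sum_mul, Finset.sum_congr rfl coeff,
      Finset.sum_const, nsmul_eq_mul]
  exact_mod_cast key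

/-- **Key lemma.** If `w ≥ 0` has nonempty support `E` and `B` is a
spectrum for `L²(w)`, then `w = c·1_E` for some constant `c > 0`. -/
theorem weight_constant_on_support_of_spectrum
    (p : ℕ) [Fact p.Prime] (d : ℕ) (hd : 1 ≤ d)
    (w : (Fin d → ZMod p) → ℝ) (hw : ∀ x, 0 ≤ w x)
    (E : Finset (Fin d → ZMod p)) (hE : E = Finset.univ.filter (fun x => w x ≠ 0))
    (hEne : E.Nonempty)
    (B : Finset (Fin d → ZMod p)) (hB : IsSpectrumW w B) :
    ∃ c : ℝ, 0 < c ∧ ∀ x, w x = if x ∈ E then c else 0 := by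
  obtain ⟨y, hyE⟩ := hEne
  have mem_iff : ∀ x, x ∈ E ↔ w x ≠ 0 := by simp [hE]
  have hy : w y ≠ 0 := (mem_iff y).1 hyE
  have hypos : 0 < w y := (hw y).lt_of_ne' hy
  refine ⟨w y, hypos, fun x => ?_⟩
  split_ifs with hx
  · have hsum : 0 < ∑ x, w x :=
      Finset.sum_pos' (fun x _ => hw x) ⟨y, Finset.mem_univ y, hypos⟩
    have hcard : (B.card : ℝ) ≠ 0 := by
      intro h0
      have h := hB.card_mul_eq_sum hy
      rw [h0, zero_mul] at h
      exact hsum.ne h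
    exact mul_left_cancel₀ hcard
      ((hB.card_mul_eq_sum ((mem_iff x).1 hx)).trans (hB.card_mul_eq_sum hy).symm)
  · exact not_not.1 (mt (mem_iff x).2 hx)
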